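/- Let 𝔏 be a finite-dimensional Leibniz algebra over a field K of characteristic zero, let R = rad(𝔏) be its solvable radical (the solvable ideal of 𝔏 containing every solvable ideal of 𝔏), and let n ≥ 2 and 2 ≤ k ≤ n. Then in the Leibniz n-algebra U_n(𝔏): (a) R is an ideal of U_n(𝔏) and is k-solvable (R^{(m)_k} = {0} for some m); and (b) every k-solvable ideal of U_n(𝔏) is contained in R. Consequently the k-solvable radical of U_n(𝔏) equals rad(𝔏) for all 2 ≤ k ≤ n. -/

import Mathlib

section Defs

variable {K L : Type*}

/-- Right-nested iterated bracket `[x₀,[x₁,[…,[xₙ₋₁,xₙ]…]]]` built from a binary bracket. -/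
def nestedBracket (b : L → L → L) : {n : ℕ} → (Fin (n + 1) → L) → L
  | 0, x => x 0
  | _ + 1, x => b (x 0) (nestedBracket b fun i => x i.succ)

/-- The (right) Leibniz identity for a binary bracket. -/
def IsLeibniz [Add L] (b : L → L → L) : Prop :=
  ∀ x y z, b (b x y) z = b (b x z) y + b x (b y z)

/-- The fundamental identity of a Leibniz `n`-algebra (arity `n + 1`). -/
def LeibnizNIdentity [AddCommMonoid L] {n : ℕ} (br : (Fin (n + 1) → L) → L) : Prop :=
  ∀ (x : Fin (n + 1) → L) (y : Fin n → L),
    br (Fin.cons (br x) y) =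
      ∑ i : Fin (n + 1), br (Function.update x i (br (Fin.cons (x i) y)))

variable [Field K] [AddCommGroup L] [Module K L]

/-- A subspace `I` is an ideal of a Leibniz `n`-algebra: it is an `s`-ideal for every
position `s`, i.e. `[z₁,…,zₙ] ∈ I` whenever some `z_s ∈ I`. -/
def IsNIdeal {n : ℕ} (br : (Fin (n + 1) → L) → L) (I : Submodule K L) : Prop :=
  ∀ (s : Fin (n + 1)) (z : Fin (n + 1) → L), z s ∈ I → br z ∈ I

/-- The Leibniz `n`-kernel: the smallest ideal containing all brackets with a repeated entry. -/
def leibnizNKernel {n : ℕ} (br : (Fin (n + 1) → L) → L) : Submodule K L :=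
  sInf {I : Submodule K L |
    IsNIdeal br I ∧ ∀ z : Fin (n + 1) → L, (∃ i j, i < j ∧ z i = z j) → br z ∈ I}

/-- A subspace `I` is a (two-sided) ideal of a Leibniz algebra. -/
def IsLeibnizIdeal (b : L →ₗ[K] L →ₗ[K] L) (I : Submodule K L) : Prop :=
  (∀ x ∈ I, ∀ y : L, b x y ∈ I) ∧ (∀ x ∈ I, ∀ y : L, b y x ∈ I)

/-- The Leibniz kernel `span {[x,x] : x ∈ L}` of a Leibniz algebra. -/
def leibnizKernel (b : L →ₗ[K] L →ₗ[K] L) : Submodule K L :=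
  Submodule.span K {v : L | ∃ x : L, b x x = v}

/-- The derived series of a subspace of a Leibniz algebra. -/
def derivedSeriesSub (b : L →ₗ[K] L →ₗ[K] L) (S : Submodule K L) : ℕ → Submodule K L
  | 0 => S
  | m + 1 => Submodule.span K
      {v : L | ∃ a ∈ derivedSeriesSub b S m, ∃ c ∈ derivedSeriesSub b S m, b a c = v}

/-- The `k`-derived series `H^{(m+1)_k}` of a subspace of a Leibniz `n`-algebra
(indexed so that index `0` corresponds to `H^{(1)_k} = H`). -/
def kSeries {n : ℕ} (br : (Fin (n + 1) → L) → L) (k : ℕ) (H : Submodule K L) :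
    ℕ → Submodule K L
  | 0 => H
  | p + 1 => Submodule.span K
      {v : L | ∃ z : Fin (n + 1) → L, ∃ s : Finset (Fin (n + 1)),
        k ≤ s.card ∧ (∀ i ∈ s, z i ∈ kSeries br k H p) ∧ br z = v}

end Defs

section LieAlgebra

/-- A finite-dimensional Lie algebra with trivial radical over a field of characteristic zero
is perfect. -/
lemma LieAlgebra.span_lie_eq_top_of_hasTrivialRadical (K G : Type*) [Field K] [CharZero K]
    [LieRing G] [LieAlgebra K G] [FiniteDimensional K G] [LieAlgebra.HasTrivialRadical K G] :
    Submodule.span K {v : G | ∃ x y : G, ⁅x, y⁆ = v} = ⊤ := by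
  by_contra hS
  obtain ⟨f, hf0, hf⟩ := Submodule.exists_le_ker_of_lt_top _ (lt_top_iff_ne_top.mpr hS)
  have hker : LinearMap.ker (killingForm K G) = ⊥ :=
    LieAlgebra.IsKilling.ker_killingForm_eq_bot K G
  have hsurj : Function.Surjective (killingForm K G) :=
    (LinearMap.injective_iff_surjective_of_finrank_eq_finrank
      (Subspace.dual_finrank_eq (K := K) (V := G)).symm).mp (LinearMap.ker_eq_bot.mp hker)
  obtain ⟨z, rfl⟩ := hsurj f
  refine hf0 ?_
  suffices z = 0 by rw [this, map_zero]
  have hz : z ∈ LieAlgebra.center K G := by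
    rw [LieModule.mem_maxTrivSubmodule]
    intro x
    rw [← lie_skew, neg_eq_zero]
    have : ⁅z, x⁆ ∈ LinearMap.ker (killingForm K G) := by
      rw [LinearMap.mem_ker]
      ext y
      rw [LieModule.traceForm_apply_lie_apply]
      exact hf (Submodule.subset_span ⟨x, y, rfl⟩)
    rwa [hker] at this
  rwa [LieAlgebra.center_eq_bot, LieSubmodule.mem_bot] at hz

/-- A finite-dimensional Lie algebra over a field of characteristic zero, given by an unbundled
bracket, is perfect as soon as it has no nonzero abelian ideal. -/
lemma span_bracket_eq_top_of_no_abelian_ideals {K G : Type*} [Field K] [CharZero K]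
    [AddCommGroup G] [Module K G] [FiniteDimensional K G] (B : G →ₗ[K] G →ₗ[K] G)
    (hself : ∀ x, B x x = 0) (hjac : ∀ x y z, B x (B y z) = B (B x y) z + B y (B x z))
    (hab : ∀ I : Submodule K G, (∀ x, ∀ y ∈ I, B x y ∈ I) →
      (∀ x ∈ I, ∀ y ∈ I, B x y = 0) → I = ⊥) :
    Submodule.span K {v : G | ∃ x y : G, B x y = v} = ⊤ := by
  let _ : LieRing G :=
    { bracket := fun x y => B x y
      add_lie := fun x y z => by simp
      lie_add := fun x y z => by simp
      lie_self := hself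
      leibniz_lie := hjac }
  let _ : LieAlgebra K G := { lie_smul := fun t x y => (B x).map_smul t y }
  have : LieAlgebra.HasTrivialRadical K G := by
    rw [LieAlgebra.hasTrivialRadical_iff_no_abelian_ideals]
    intro I hI
    rw [← LieSubmodule.toSubmodule_eq_bot]
    refine hab _ (fun x y hy => lie_mem_right K G I x y hy) fun x hx y hy => ?_
    exact congrArg Subtype.val (hI.trivial ⟨x, hx⟩ ⟨y, hy⟩)
  exact LieAlgebra.span_lie_eq_top_of_hasTrivialRadical K G

end LieAlgebra

section Leibniz

variable {K L : Type*} [Field K] [AddCommGroup L] [Module K L] {b : L →ₗ[K] L →ₗ[K] L}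

lemma derivedSeriesSub_mono {S T : Submodule K L} (h : S ≤ T) (p : ℕ) :
    derivedSeriesSub b S p ≤ derivedSeriesSub b T p := by
  induction p with
  | zero => exact h
  | succ p ih =>
    refine Submodule.span_mono ?_
    rintro v ⟨a, ha, c, hc, rfl⟩
    exact ⟨a, ih ha, c, ih hc, rfl⟩

lemma derivedSeriesSub_add (S : Submodule K L) (p q : ℕ) :
    derivedSeriesSub b S (p + q) = derivedSeriesSub b (derivedSeriesSub b S p) q := by
  induction q with
  | zero => rfl
  | succ q ih => rw [← add_assoc, derivedSeriesSub, derivedSeriesSub, ih]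

/-- A subspace with some term of its derived series in a solvable subspace is solvable. -/
lemma exists_derivedSeriesSub_eq_bot_of_le {S T : Submodule K L} {q : ℕ}
    (h : derivedSeriesSub b S q ≤ T) (hT : ∃ p, derivedSeriesSub b T p = ⊥) :
    ∃ p, derivedSeriesSub b S p = ⊥ := by
  obtain ⟨p, hp⟩ := hT
  refine ⟨q + p, ?_⟩
  rw [derivedSeriesSub_add, eq_bot_iff, ← hp]
  exact derivedSeriesSub_mono h p

lemma IsLeibnizIdeal.span_bracket (hb : IsLeibniz fun x y => b x y) {I : Submodule K L}
    (hI : IsLeibnizIdeal b I) :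
    IsLeibnizIdeal b (Submodule.span K {v : L | ∃ a ∈ I, ∃ c ∈ I, b a c = v}) := by
  constructor
  · intro x hx y
    induction hx using Submodule.span_induction with
    | mem x hx =>
      obtain ⟨a, ha, c, hc, rfl⟩ := hx
      have := hb a c y
      simp only at this
      rw [this]
      exact add_mem (Submodule.subset_span ⟨_, hI.1 a ha y, c, hc, rfl⟩)
        (Submodule.subset_span ⟨a, ha, _, hI.1 c hc y, rfl⟩)
    | zero => simp
    | add u v _ _ hu hv => rw [map_add, LinearMap.add_apply]; exact add_mem hu hv
    | smul t u _ hu => rw [map_smul, LinearMap.smul_apply]; exact Submodule.smul_mem _ _ hu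
  · intro x hx y
    induction hx using Submodule.span_induction with
    | mem x hx =>
      obtain ⟨a, ha, c, hc, rfl⟩ := hx
      have := hb y a c
      simp only at this
      rw [← sub_eq_iff_eq_add'.mpr this]
      exact sub_mem (Submodule.subset_span ⟨_, hI.2 a ha y, c, hc, rfl⟩)
        (Submodule.subset_span ⟨_, hI.2 c hc y, a, ha, rfl⟩)
    | zero => simp
    | add u v _ _ hu hv => rw [map_add]; exact add_mem hu hv
    | smul t u _ hu => rw [map_smul]; exact Submodule.smul_mem _ _ hu

lemma isLeibnizIdeal_derivedSeriesSub (hb : IsLeibniz fun x y => b x y) {I : Submodule K L}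
    (hI : IsLeibnizIdeal b I) (p : ℕ) : IsLeibnizIdeal b (derivedSeriesSub b I p) := by
  induction p with
  | zero => exact hI
  | succ p ih => exact ih.span_bracket hb

lemma bracket_self_right (hb : IsLeibniz fun x y => b x y) (x y : L) : b y (b x x) = 0 := by
  have := hb y x x
  simpa using this

lemma bracket_leibnizKernel_right (hb : IsLeibniz fun x y => b x y) (y : L) {x : L}
    (hx : x ∈ leibnizKernel b) : b y x = 0 := by
  have : leibnizKernel b ≤ LinearMap.ker (b y) := by
    refine Submodule.span_le.mpr ?_
    rintro v ⟨x, rfl⟩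
    exact bracket_self_right hb x y
  exact this hx

lemma isLeibnizIdeal_leibnizKernel (hb : IsLeibniz fun x y => b x y) :
    IsLeibnizIdeal b (leibnizKernel b) := by
  refine ⟨fun x hx y => ?_, fun x hx y => ?_⟩
  · have h : leibnizKernel b ≤ (leibnizKernel b).comap (b.flip y) := by
      refine Submodule.span_le.mpr ?_
      rintro v ⟨x, rfl⟩
      have h1 := hb x x y
      simp only at h1
      have h2 : b (b x x) y =
          b (x + b x y) (x + b x y) - b x x - b (b x y) (b x y) := by
        rw [h1]; simp only [map_add, LinearMap.add_apply]; abel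
      simp only [SetLike.mem_coe, Submodule.mem_comap, LinearMap.flip_apply]
      rw [h2]
      exact sub_mem (sub_mem (Submodule.subset_span ⟨_, rfl⟩) (Submodule.subset_span ⟨_, rfl⟩))
        (Submodule.subset_span ⟨_, rfl⟩)
    exact h hx
  · rw [bracket_leibnizKernel_right hb y hx]
    exact zero_mem _

lemma derivedSeriesSub_leibnizKernel (hb : IsLeibniz fun x y => b x y) :
    derivedSeriesSub b (leibnizKernel b) 1 = ⊥ := by
  rw [derivedSeriesSub, Submodule.span_eq_bot]
  rintro v ⟨a, -, c, hc, rfl⟩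
  exact bracket_leibnizKernel_right hb a hc

/-- The bracket induced on the quotient of a Leibniz algebra by an ideal. -/
def quotientBracket (R : Submodule K L) (hR : IsLeibnizIdeal b R) :
    (L ⧸ R) →ₗ[K] (L ⧸ R) →ₗ[K] (L ⧸ R) :=
  R.liftQ
    { toFun := fun x => R.mapQ R (b x) fun y hy => hR.2 y hy x
      map_add' := fun x y => by ext; simp
      map_smul' := fun t x => by ext; simp }
    fun x hx => by
      rw [LinearMap.mem_ker]
      ext y
      simpa using hR.1 x hx y

@[simp]
lemma quotientBracket_mk (R : Submodule K L) (hR : IsLeibnizIdeal b R) (x y : L) :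
    quotientBracket R hR (R.mkQ x) (R.mkQ y) = R.mkQ (b x y) := rfl

/-- Modulo its solvable radical, a finite-dimensional Leibniz algebra over a field of
characteristic zero is perfect. -/
lemma span_bracket_sup_radical_eq_top [CharZero K] [FiniteDimensional K L]
    (hb : IsLeibniz fun x y => b x y) {R : Submodule K L} (hR : IsLeibnizIdeal b R)
    (hRsolv : ∃ p, derivedSeriesSub b R p = ⊥)
    (hRmax : ∀ I : Submodule K L, IsLeibnizIdeal b I →
      (∃ p, derivedSeriesSub b I p = ⊥) → I ≤ R) :
    Submodule.span K {v : L | ∃ x y : L, b x y = v} ⊔ R = ⊤ := by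
  have hker : leibnizKernel b ≤ R :=
    hRmax _ (isLeibnizIdeal_leibnizKernel hb) ⟨1, derivedSeriesSub_leibnizKernel hb⟩
  have hself : ∀ x, quotientBracket R hR x x = 0 := by
    intro x
    obtain ⟨x, rfl⟩ := R.mkQ_surjective x
    rw [quotientBracket_mk, ← LinearMap.mem_ker, R.ker_mkQ]
    exact hker (Submodule.subset_span ⟨x, rfl⟩)
  have hskew : ∀ x y, quotientBracket R hR x y = -quotientBracket R hR y x := by
    intro x y
    have := hself (x + y)
    simp only [map_add, LinearMap.add_apply, hself, zero_add, add_zero] at this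
    rw [add_comm] at this
    exact eq_neg_of_add_eq_zero_left this
  have hjac : ∀ x y z, quotientBracket R hR x (quotientBracket R hR y z) =
      quotientBracket R hR (quotientBracket R hR x y) z +
        quotientBracket R hR y (quotientBracket R hR x z) := by
    intro x y z
    have key : quotientBracket R hR (quotientBracket R hR x y) z =
        quotientBracket R hR (quotientBracket R hR x z) y +
          quotientBracket R hR x (quotientBracket R hR y z) := by
      obtain ⟨x, rfl⟩ := R.mkQ_surjective x
      obtain ⟨y, rfl⟩ := R.mkQ_surjective y
      obtain ⟨z, rfl⟩ := R.mkQ_surjective z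
      simp only [quotientBracket_mk, ← map_add]
      exact congrArg R.mkQ (hb x y z)
    rw [key, hskew y (quotientBracket R hR x z)]
    abel
  have htop := span_bracket_eq_top_of_no_abelian_ideals (quotientBracket R hR) hself hjac <| by
    intro I hI hI0
    have hle : I.comap R.mkQ ≤ R := by
      refine hRmax _ ⟨fun x hx y => ?_, fun x hx y => ?_⟩
        (exists_derivedSeriesSub_eq_bot_of_le (q := 1) (Submodule.span_le.mpr ?_) hRsolv)
      · rw [Submodule.mem_comap, ← quotientBracket_mk R hR, hskew]
        exact I.neg_mem (hI _ _ hx)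
      · rw [Submodule.mem_comap, ← quotientBracket_mk R hR]
        exact hI _ _ hx
      · rintro v ⟨a, ha, c, hc, rfl⟩
        rw [SetLike.mem_coe, ← R.ker_mkQ, LinearMap.mem_ker, ← quotientBracket_mk R hR]
        exact hI0 _ ha _ hc
    rw [eq_bot_iff]
    intro x hx
    obtain ⟨x, rfl⟩ := R.mkQ_surjective x
    rw [Submodule.mem_bot, ← LinearMap.mem_ker, R.ker_mkQ]
    exact hle hx
  rw [← R.ker_mkQ, ← Submodule.comap_map_eq, Submodule.map_span, ← Submodule.comap_top R.mkQ,
    ← htop]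
  congr 2
  ext v
  constructor
  · rintro ⟨_, ⟨x, y, rfl⟩, rfl⟩
    exact ⟨R.mkQ x, R.mkQ y, rfl⟩
  · rintro ⟨x, y, rfl⟩
    obtain ⟨x, rfl⟩ := R.mkQ_surjective x
    obtain ⟨y, rfl⟩ := R.mkQ_surjective y
    exact ⟨_, ⟨x, y, rfl⟩, rfl⟩

end Leibniz

section NestedBracket

variable {K L : Type*} [Field K] [AddCommGroup L] [Module K L] {b : L →ₗ[K] L →ₗ[K] L}

lemma IsLeibnizIdeal.isNIdeal {I : Submodule K L} (hI : IsLeibnizIdeal b I) (n : ℕ) :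
    IsNIdeal (nestedBracket (n := n) fun x y => b x y) I := by
  induction n with
  | zero =>
    intro s z hs
    rwa [Fin.fin_one_eq_zero s] at hs
  | succ n ih =>
    intro s z hs
    induction s using Fin.cases with
    | zero => exact hI.1 _ hs _
    | succ s => exact hI.2 _ (ih s _ hs) _

/-- A nested bracket with two entries in an ideal `I` lies in any ideal containing `[I, I]`. -/
lemma nestedBracket_mem_of_lt {I J : Submodule K L} (hI : IsLeibnizIdeal b I)
    (hJ : IsLeibnizIdeal b J) (hIJ : ∀ x ∈ I, ∀ y ∈ I, b x y ∈ J) {n : ℕ}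
    (z : Fin (n + 1) → L) {s t : Fin (n + 1)} (hst : s < t) (hs : z s ∈ I) (ht : z t ∈ I) :
    nestedBracket (fun x y => b x y) z ∈ J := by
  induction n with
  | zero => omega
  | succ n ih =>
    obtain ⟨t, rfl⟩ := Fin.exists_succ_eq.mpr (Fin.ne_zero_of_lt hst)
    induction s using Fin.cases with
    | zero => exact hIJ _ hs _ (hI.isNIdeal n t _ ht)
    | succ s => exact hJ.2 _ (ih (fun i => z i.succ) (Fin.succ_lt_succ_iff.mp hst) hs ht) _

lemma kSeries_le_derivedSeriesSub (hb : IsLeibniz fun x y => b x y) {I : Submodule K L}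
    (hI : IsLeibnizIdeal b I) {k : ℕ} (hk : 2 ≤ k) (n p : ℕ) :
    kSeries (nestedBracket (n := n) fun x y => b x y) k I p ≤ derivedSeriesSub b I p := by
  induction p with
  | zero => exact le_rfl
  | succ p ih =>
    refine Submodule.span_le.mpr ?_
    rintro v ⟨z, s, hs, hz, rfl⟩
    obtain ⟨i, hi, j, hj, hij⟩ := Finset.one_lt_card.mp (hk.trans hs)
    wlog hlt : i < j generalizing i j
    · exact this j hj i hi hij.symm (lt_of_le_of_ne (not_lt.mp hlt) hij.symm)
    exact nestedBracket_mem_of_lt (isLeibnizIdeal_derivedSeriesSub hb hI p)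
      (isLeibnizIdeal_derivedSeriesSub hb hI (p + 1))
      (fun x hx y hy => Submodule.subset_span ⟨x, hx, y, hy, rfl⟩) z hlt (ih (hz i hi))
      (ih (hz j hj))

lemma IsLeibnizIdeal.derivedSeriesSub_le {I : Submodule K L} (hI : IsLeibnizIdeal b I)
    (p : ℕ) : derivedSeriesSub b I p ≤ I := by
  have h1 : derivedSeriesSub b I 1 ≤ I := by
    refine Submodule.span_le.mpr ?_
    rintro v ⟨a, ha, c, -, rfl⟩
    exact hI.1 a ha c
  induction p with
  | zero => exact le_rfl
  | succ p ih =>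
    rw [add_comm, derivedSeriesSub_add]
    exact (derivedSeriesSub_mono h1 p).trans ih

lemma derivedSeriesSub_le_span_nestedBracket {I : Submodule K L} (hI : IsLeibnizIdeal b I)
    (n : ℕ) :
    derivedSeriesSub b I n ≤ Submodule.span K {v : L | ∃ z : Fin (n + 1) → L,
      (∀ i, z i ∈ I) ∧ nestedBracket (fun x y => b x y) z = v} := by
  induction n with
  | zero => exact fun x hx => Submodule.subset_span ⟨fun _ => x, fun _ => hx, rfl⟩
  | succ n ih =>
    refine Submodule.span_le.mpr ?_
    rintro v ⟨a, ha, c, hc, rfl⟩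
    replace ha := hI.derivedSeriesSub_le n ha
    suffices h : derivedSeriesSub b I n ≤ (Submodule.span K _).comap (b a) from h hc
    refine ih.trans (Submodule.span_le.mpr ?_)
    rintro v ⟨z, hz, rfl⟩
    exact Submodule.subset_span
      ⟨Fin.cons a z, fun i => Fin.cases ha hz i, by simp [nestedBracket]⟩

lemma nestedBracket_sub_mem {R : Submodule K L} (hR : IsLeibnizIdeal b R) {n : ℕ}
    (z w : Fin (n + 1) → L) (h : ∀ i, z i - w i ∈ R) :
    nestedBracket (fun x y => b x y) z - nestedBracket (fun x y => b x y) w ∈ R := by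
  induction n with
  | zero => exact h 0
  | succ n ih =>
    simp only [nestedBracket]
    rw [← sub_add_sub_cancel _ (b (w 0) (nestedBracket (fun x y => b x y) fun i => z i.succ)),
      ← LinearMap.sub_apply, ← map_sub, ← map_sub]
    exact R.add_mem (hR.1 _ (h 0) _) (hR.2 _ (ih _ _ fun i => h i.succ) _)

lemma derivedSeriesSub_mul_le_kSeries_sup {R H : Submodule K L} (hb : IsLeibniz fun x y => b x y)
    (hR : IsLeibnizIdeal b R) (hHR : IsLeibnizIdeal b (H ⊔ R)) {n k : ℕ} (hk : k ≤ n + 1)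
    (p : ℕ) :
    derivedSeriesSub b (H ⊔ R) (n * p) ≤
      kSeries (nestedBracket (n := n) fun x y => b x y) k H p ⊔ R := by
  induction p with
  | zero => exact le_rfl
  | succ p ih =>
    rw [Nat.mul_succ, derivedSeriesSub_add]
    refine (derivedSeriesSub_le_span_nestedBracket
      (isLeibnizIdeal_derivedSeriesSub hb hHR (n * p)) n).trans (Submodule.span_le.mpr ?_)
    rintro v ⟨z, hz, rfl⟩
    choose w hw r hr hwr using fun i => Submodule.mem_sup.mp (ih (hz i))
    refine Submodule.mem_sup.mpr ⟨nestedBracket (fun x y => b x y) w, Submodule.subset_span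
      ⟨w, Finset.univ, by simpa using hk, fun i _ => hw i, rfl⟩, _,
      nestedBracket_sub_mem hR z w fun i => ?_, add_sub_cancel _ _⟩
    rw [← hwr, add_sub_cancel_left]
    exact hr i

lemma span_nestedBracket_sup_eq_top {R : Submodule K L} (hR : IsLeibnizIdeal b R)
    (hperf : Submodule.span K {v : L | ∃ x y : L, b x y = v} ⊔ R = ⊤) (n : ℕ) :
    Submodule.span K {v : L | ∃ z : Fin (n + 1) → L,
      nestedBracket (fun x y => b x y) z = v} ⊔ R = ⊤ := by
  induction n with
  | zero =>
    rw [eq_top_iff]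
    exact fun x _ => Submodule.mem_sup_left (Submodule.subset_span ⟨fun _ => x, rfl⟩)
  | succ n ih =>
    rw [eq_top_iff, ← hperf]
    refine sup_le (Submodule.span_le.mpr ?_) le_sup_right
    rintro v ⟨x, y, rfl⟩
    suffices h : (⊤ : Submodule K L) ≤ (Submodule.span K _ ⊔ R).comap (b x) from
      h (Submodule.mem_top (x := y))
    rw [← ih]
    refine sup_le (Submodule.span_le.mpr ?_) fun r hr => Submodule.mem_sup_right (hR.2 r hr x)
    rintro v ⟨z, rfl⟩
    exact Submodule.mem_sup_left (Submodule.subset_span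
      ⟨Fin.cons x z, by simp [nestedBracket]⟩)

/-- If a Leibniz algebra is perfect modulo an ideal `R` containing its Leibniz kernel, then every
ideal of the associated Leibniz `n`-algebra becomes an ideal after adding `R`. -/
lemma IsNIdeal.isLeibnizIdeal_sup {R H : Submodule K L} (hR : IsLeibnizIdeal b R)
    (hker : leibnizKernel b ≤ R)
    (hperf : Submodule.span K {v : L | ∃ x y : L, b x y = v} ⊔ R = ⊤) {n : ℕ}
    (hn : 1 ≤ n) (hH : IsNIdeal (nestedBracket (n := n) fun x y => b x y) H) :
    IsLeibnizIdeal b (H ⊔ R) := by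
  obtain ⟨m, rfl⟩ := Nat.exists_eq_add_of_le' hn
  have hright : ∀ h ∈ H, ∀ y, b h y ∈ H ⊔ R := by
    intro h hh y
    suffices hle : (⊤ : Submodule K L) ≤ (H ⊔ R).comap (b h) from
      hle (Submodule.mem_top (x := y))
    rw [← span_nestedBracket_sup_eq_top hR hperf m]
    refine sup_le (Submodule.span_le.mpr ?_) fun r hr => Submodule.mem_sup_right (hR.2 r hr h)
    rintro v ⟨z, rfl⟩
    refine Submodule.mem_sup_left ?_
    simpa [nestedBracket] using hH 0 (Fin.cons h z) (by simpa using hh)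
  have hskew : ∀ x y, b x y + b y x ∈ R := by
    intro x y
    have h : b x y + b y x = b (x + y) (x + y) - b x x - b y y := by
      simp only [map_add, LinearMap.add_apply]
      abel
    have hsq : ∀ u, b u u ∈ R := fun u => hker (Submodule.subset_span ⟨u, rfl⟩)
    rw [h]
    exact R.sub_mem (R.sub_mem (hsq _) (hsq _)) (hsq _)
  constructor
  · intro x hx y
    obtain ⟨h, hh, r, hr, rfl⟩ := Submodule.mem_sup.mp hx
    rw [map_add, LinearMap.add_apply]
    exact add_mem (hright h hh y) (Submodule.mem_sup_right (hR.1 r hr y))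
  · intro x hx y
    obtain ⟨h, hh, r, hr, rfl⟩ := Submodule.mem_sup.mp hx
    rw [map_add]
    refine add_mem ?_ (Submodule.mem_sup_right (hR.2 r hr y))
    rw [← add_sub_cancel_right (b y h) (b h y)]
    exact sub_mem (Submodule.mem_sup_right (hskew y h)) (hright h hh y)

end NestedBracket

/-- Let `𝔏` be a finite-dimensional Leibniz algebra over a field of
characteristic zero with solvable radical `R = rad(𝔏)`, and let `n ≥ 2`
(arity `n + 1`, `1 ≤ n`) and `2 ≤ k ≤ n + 1`. Then in `U_n(𝔏)`:
(a) `R` is a `k`-solvable ideal of `U_n(𝔏)`, and (b) every `k`-solvable ideal of `U_n(𝔏)`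
is contained in `R`; i.e. the `k`-solvable radical of `U_n(𝔏)` equals `rad(𝔏)`. -/
theorem stmt_18 {K L : Type*} [Field K] [CharZero K] [AddCommGroup L] [Module K L]
    [FiniteDimensional K L]
    (b : L →ₗ[K] L →ₗ[K] L) (hb : IsLeibniz fun x y => b x y)
    (R : Submodule K L) (hRid : IsLeibnizIdeal b R)
    (hRsolv : ∃ p, derivedSeriesSub b R p = ⊥)
    (hRmax : ∀ I : Submodule K L, IsLeibnizIdeal b I →
      (∃ p, derivedSeriesSub b I p = ⊥) → I ≤ R)
    (n k : ℕ) (hn : 1 ≤ n) (hk2 : 2 ≤ k) (hkn : k ≤ n + 1) :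
    (IsNIdeal (nestedBracket (n := n) fun x y => b x y) R ∧
        ∃ p, kSeries (nestedBracket (n := n) fun x y => b x y) k R p = ⊥) ∧
      ∀ H : Submodule K L, IsNIdeal (nestedBracket (n := n) fun x y => b x y) H →
        (∃ p, kSeries (nestedBracket (n := n) fun x y => b x y) k H p = ⊥) → H ≤ R := by
  have hker : leibnizKernel b ≤ R :=
    hRmax _ (isLeibnizIdeal_leibnizKernel hb) ⟨1, derivedSeriesSub_leibnizKernel hb⟩
  refine ⟨⟨hRid.isNIdeal n, ?_⟩, ?_⟩
  · obtain ⟨p, hp⟩ := hRsolv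
    exact ⟨p, eq_bot_iff.mpr (hp ▸ kSeries_le_derivedSeriesSub hb hRid hk2 n p)⟩
  · rintro H hH ⟨p, hp⟩
    have hHR : IsLeibnizIdeal b (H ⊔ R) := hH.isLeibnizIdeal_sup hRid hker
      (span_bracket_sup_radical_eq_top hb hRid hRsolv hRmax) hn
    have hle := derivedSeriesSub_mul_le_kSeries_sup hb hRid hHR hkn p
    rw [hp, bot_sup_eq] at hle
    exact le_sup_left.trans (hRmax _ hHR (exists_derivedSeriesSub_eq_bot_of_le hle hRsolv))
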